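/- Vanishing relative error when the lower bound is l = Σl* (Theorem 3, first part): assume that for each γ > 0 there exists a minimizer μ*(γ) ∈ ℝ^d of μ ↦ sup_{x∈𝒞_γ} ψ_γ(x;μ), and define M(γ) = ∫_{𝒞_γ} exp(ψ_γ(x;μ*(γ))) φ_d(x) dx. Then lim_{γ→∞} M(γ)/ℓ(γ)² = 1, i.e., the minimax exponentially tilted estimator of ℓ(γ) has vanishing relative error as γ → ∞. -/

import Mathlib

open MeasureTheory Real Filter Matrix

/-- Standard normal density on ℝ. -/
noncomputable def stdPdf (t : ℝ) : ℝ := (Real.sqrt (2 * Real.pi))⁻¹ * Real.exp (-t ^ 2 / 2)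

/-- Standard normal cumulative distribution function Φ. -/
noncomputable def Phi (t : ℝ) : ℝ := ∫ s in Set.Iic t, stdPdf s

/-- Standard `d`-dimensional normal density φ_d(x) = (2π)^{-d/2} exp(-‖x‖²/2). -/
noncomputable def phiD {d : ℕ} (x : Fin d → ℝ) : ℝ :=
  ((Real.sqrt (2 * Real.pi)) ^ d)⁻¹ * Real.exp (-(∑ i, x i ^ 2) / 2)

/-- The region of integration 𝒞_γ = {x : Lx ≥ γ Σ l*}, where Σ = LLᵀ. -/
def Cgam {d : ℕ} (L : Matrix (Fin d) (Fin d) ℝ) (lstar : Fin d → ℝ) (γ : ℝ) :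
    Set (Fin d → ℝ) := {x | ∀ i, γ * (L * Lᵀ).mulVec lstar i ≤ L.mulVec x i}

/-- ℓ(γ) = P(LZ ≥ γ Σ l*) = ∫_{𝒞_γ} φ_d(x) dx. -/
noncomputable def ellGam {d : ℕ} (L : Matrix (Fin d) (Fin d) ℝ) (lstar : Fin d → ℝ)
    (γ : ℝ) : ℝ := ∫ x in Cgam L lstar γ, phiD x

/-- One-sided sequential bound l̃ᵧ_k(x) = (γ(Σl*)_k − Σ_{j<k} L_{kj} x_j)/L_{kk}. -/
noncomputable def lTilGam {d : ℕ} (L : Matrix (Fin d) (Fin d) ℝ) (lstar : Fin d → ℝ) (γ : ℝ)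
    (x : Fin d → ℝ) (k : Fin d) : ℝ :=
  (γ * (L * Lᵀ).mulVec lstar k - ∑ j ∈ Finset.Iio k, L k j * x j) / L k k

/-- ψ_γ(x;μ) = −xᵀμ + ‖μ‖²/2 + Σ_k log(1 − Φ(l̃ᵧ_k(x) − μ_k)). -/
noncomputable def psiGam {d : ℕ} (L : Matrix (Fin d) (Fin d) ℝ) (lstar : Fin d → ℝ) (γ : ℝ)
    (x μ : Fin d → ℝ) : ℝ :=
  -(∑ i, x i * μ i) + (∑ i, μ i ^ 2) / 2 +
    ∑ k, Real.log (1 - Phi (lTilGam L lstar γ x k - μ k))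

/-- Second moment of the exponentially tilted estimator with tilting parameter μ(γ):
M(γ) = ∫_{𝒞_γ} exp(ψ_γ(x;μ(γ))) φ_d(x) dx. -/
noncomputable def Mgam {d : ℕ} (L : Matrix (Fin d) (Fin d) ℝ) (lstar : Fin d → ℝ)
    (μ : ℝ → Fin d → ℝ) (γ : ℝ) : ℝ :=
  ∫ x in Cgam L lstar γ, Real.exp (psiGam L lstar γ x (μ γ)) * phiD x

lemma stdPdf_eq_gaussianPDFReal : stdPdf = ProbabilityTheory.gaussianPDFReal 0 1 := by
  ext t
  simp [stdPdf, ProbabilityTheory.gaussianPDFReal]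

lemma stdPdf_pos (t : ℝ) : 0 < stdPdf t := by
  unfold stdPdf; positivity

lemma continuous_stdPdf : Continuous stdPdf := by
  unfold stdPdf; fun_prop

lemma integrable_stdPdf : Integrable stdPdf := by
  rw [stdPdf_eq_gaussianPDFReal]
  exact ProbabilityTheory.integrable_gaussianPDFReal 0 1

lemma integral_stdPdf : ∫ t, stdPdf t = 1 := by
  rw [stdPdf_eq_gaussianPDFReal]
  exact ProbabilityTheory.integral_gaussianPDFReal_eq_one 0 one_ne_zero

lemma one_sub_Phi (t : ℝ) : 1 - Phi t = ∫ s in Set.Ioi t, stdPdf s := by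
  have h := integral_add_compl (measurableSet_Iic (a := t)) integrable_stdPdf
  rw [integral_stdPdf, Set.compl_Iic] at h
  rw [Phi]
  linarith

lemma one_sub_Phi_pos (t : ℝ) : 0 < 1 - Phi t := by
  rw [one_sub_Phi]
  exact (setIntegral_pos_iff_support_of_nonneg_ae (ae_of_all _ fun s => (stdPdf_pos s).le)
    integrable_stdPdf.integrableOn).2 (by
      have : Function.support stdPdf = Set.univ := by
        ext s; simpa using (stdPdf_pos s).ne'
      simp [this])

lemma measurable_Phi : Measurable Phi := by
  refine Monotone.measurable fun s t hst => ?_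
  exact setIntegral_mono_set integrable_stdPdf.integrableOn
    (ae_of_all _ fun s => (stdPdf_pos s).le) (Set.Iic_subset_Iic.2 hst).eventuallyLE

/-- Chernoff bound for the normal tail, with the tail integral of the tangent exponential. -/
lemma one_sub_Phi_le {s : ℝ} (hs : 0 < s) (t : ℝ) :
    1 - Phi t ≤ (√(2 * π))⁻¹ / s * exp (s ^ 2 / 2 - s * t) := by
  rw [one_sub_Phi]
  have hint := (integrableOn_exp_mul_Ioi (neg_lt_zero.2 hs) t).const_mul
    ((√(2 * π))⁻¹ * exp (s ^ 2 / 2))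
  calc ∫ y in Set.Ioi t, stdPdf y
      ≤ ∫ y in Set.Ioi t, (√(2 * π))⁻¹ * exp (s ^ 2 / 2) * exp (-s * y) := by
        refine setIntegral_mono integrable_stdPdf.integrableOn hint fun y => ?_
        rw [stdPdf, mul_assoc, ← exp_add]
        gcongr
        nlinarith [sq_nonneg (y - s)]
    _ = (√(2 * π))⁻¹ / s * exp (s ^ 2 / 2 - s * t) := by
        rw [integral_const_mul, integral_exp_mul_Ioi (neg_lt_zero.2 hs), sub_eq_add_neg, exp_add,
          neg_mul]
        field_simp

/-- Sequential integration: a product of factors, the `k`-th of which depends only on the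
coordinates up to `k` and has integral at most one in the `k`-th coordinate, has integral at most
one. -/
lemma lintegral_prod_sequential_le_one {ι : Type*} [Fintype ι] [LinearOrder ι]
    {f : ι → (ι → ℝ) → ENNReal} (hf : ∀ k, Measurable (f k))
    (hdep : ∀ k j, k < j → ∀ x t, f k (Function.update x j t) = f k x)
    (hle : ∀ k x, ∫⁻ t, f k (Function.update x k t) ≤ 1) :
    ∫⁻ x, ∏ k, f k x ≤ 1 := by
  have key : ∀ s : Finset ι,
      ∀ x, lmarginal (fun _ => volume) s (fun x => ∏ k ∈ s, f k x) x ≤ 1 := by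
    intro s
    induction s using Finset.induction_on_max with
    | empty => simp
    | insert a s ha ih =>
      have has : a ∉ s := fun h => lt_irrefl _ (ha a h)
      intro x
      rw [lmarginal_insert' _ (by fun_prop) has]
      refine le_trans (lmarginal_mono (fun y => ?_) x) (ih x)
      have h : ∀ t, ∏ k ∈ insert a s, f k (Function.update y a t) =
          (∏ k ∈ s, f k y) * f a (Function.update y a t) := fun t => by
        rw [Finset.prod_insert has, mul_comm]
        congr 1
        exact Finset.prod_congr rfl fun k hk => hdep k a (ha k hk) y t
      simp only [h]
      have hm : Measurable fun t => f a (Function.update y a t) :=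
        (hf a).comp (measurable_update y)
      rw [lintegral_const_mul _ hm]
      exact mul_le_of_le_one_right (zero_le) (hle a y)
  have h := key Finset.univ 0
  rwa [lmarginal_univ] at h

section Tilting

variable {d : ℕ} {L : Matrix (Fin d) (Fin d) ℝ} {lstar : Fin d → ℝ}

lemma mulVec_eq_sum_Iio_add (hLow : ∀ i j : Fin d, i < j → L i j = 0) (x : Fin d → ℝ)
    (k : Fin d) : L.mulVec x k = ∑ j ∈ Finset.Iio k, L k j * x j + L k k * x k := by
  rw [Matrix.mulVec, dotProduct, ← Finset.sum_subset (Finset.subset_univ (Finset.Iic k)),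
    ← Finset.Iio_insert, Finset.sum_insert (by simp), add_comm]
  intro j _ hj
  rw [hLow k j (by simpa using hj), zero_mul]

lemma mem_Cgam_iff (hLow : ∀ i j : Fin d, i < j → L i j = 0) (hDiag : ∀ i, 0 < L i i)
    {γ : ℝ} {x : Fin d → ℝ} : x ∈ Cgam L lstar γ ↔ ∀ k, lTilGam L lstar γ x k ≤ x k := by
  refine forall_congr' fun k => ?_
  rw [lTilGam, div_le_iff₀ (hDiag k), mulVec_eq_sum_Iio_add hLow]
  constructor <;> intro h <;> linarith

lemma measurableSet_Cgam {γ : ℝ} : MeasurableSet (Cgam L lstar γ) := by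
  have : Cgam L lstar γ = ⋂ i, {x | γ * (L * Lᵀ).mulVec lstar i ≤ L.mulVec x i} := by
    ext x; simp [Cgam]
  rw [this]
  refine MeasurableSet.iInter fun i => measurableSet_le measurable_const ?_
  unfold Matrix.mulVec dotProduct
  fun_prop

lemma measurable_lTilGam {γ : ℝ} (k : Fin d) : Measurable fun x => lTilGam L lstar γ x k := by
  unfold lTilGam
  fun_prop

lemma measurable_psiGam {γ : ℝ} (μ : Fin d → ℝ) : Measurable fun x => psiGam L lstar γ x μ := by
  have h : ∀ k, Measurable fun x => Phi (lTilGam L lstar γ x k - μ k) := fun k =>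
    measurable_Phi.comp ((measurable_lTilGam k).sub_const _)
  unfold psiGam
  fun_prop

lemma phiD_eq_prod (x : Fin d → ℝ) : phiD x = ∏ k, stdPdf (x k) := by
  simp only [phiD, stdPdf, Finset.prod_mul_distrib, ← exp_sum, Finset.prod_const,
    Finset.card_univ, Fintype.card_fin, inv_pow, ← Finset.sum_div, Finset.sum_neg_distrib]

lemma phiD_pos (x : Fin d → ℝ) : 0 < phiD x := by
  unfold phiD; positivity

lemma continuous_phiD : Continuous (phiD : (Fin d → ℝ) → ℝ) := by
  unfold phiD; fun_prop

lemma integrable_phiD : Integrable (phiD : (Fin d → ℝ) → ℝ) := by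
  have h : (phiD : (Fin d → ℝ) → ℝ) = fun x => ∏ k, stdPdf (x k) := funext phiD_eq_prod
  rw [h]
  exact Integrable.fintype_prod fun _ => integrable_stdPdf

lemma exp_neg_psiGam_mul_phiD (γ : ℝ) (μ x : Fin d → ℝ) :
    exp (-psiGam L lstar γ x μ) * phiD x =
      ∏ k, stdPdf (x k - μ k) / (1 - Phi (lTilGam L lstar γ x k - μ k)) := by
  have h : ∀ k, stdPdf (x k - μ k) / (1 - Phi (lTilGam L lstar γ x k - μ k)) =
      stdPdf (x k) * exp (x k * μ k - μ k ^ 2 / 2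
        - log (1 - Phi (lTilGam L lstar γ x k - μ k))) := fun k => by
    rw [exp_sub, exp_log (one_sub_Phi_pos _), stdPdf, stdPdf, mul_div_assoc', mul_assoc,
      ← exp_add]
    congr 3
    ring
  simp only [h, Finset.prod_mul_distrib, ← phiD_eq_prod, ← exp_sum, Finset.sum_sub_distrib,
    ← Finset.sum_div]
  rw [mul_comm, psiGam]
  congr 2
  ring

/-- The tilted sequential proposal density has total mass at most one. -/
lemma lintegral_tilted_le_one (hLow : ∀ i j : Fin d, i < j → L i j = 0)
    (hDiag : ∀ i, 0 < L i i) (γ : ℝ) (μ : Fin d → ℝ) :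
    ∫⁻ x in Cgam L lstar γ, ENNReal.ofReal (exp (-psiGam L lstar γ x μ) * phiD x) ≤ 1 := by
  let f : Fin d → (Fin d → ℝ) → ENNReal := fun k x =>
    if lTilGam L lstar γ x k ≤ x k then
      ENNReal.ofReal (stdPdf (x k - μ k) / (1 - Phi (lTilGam L lstar γ x k - μ k)))
    else 0
  have hf : ∀ k, Measurable (f k) := fun k => by
    have h1 : Measurable fun x => Phi (lTilGam L lstar γ x k - μ k) :=
      measurable_Phi.comp ((measurable_lTilGam k).sub_const _)
    have h2 : Measurable fun x : Fin d → ℝ => stdPdf (x k - μ k) :=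
      continuous_stdPdf.measurable.comp (by fun_prop)
    exact Measurable.ite (measurableSet_le (measurable_lTilGam k) (measurable_pi_apply k))
      (by fun_prop) measurable_const
  have hlt : ∀ k j, k ≤ j → ∀ x t,
      lTilGam L lstar γ (Function.update x j t) k = lTilGam L lstar γ x k := by
    intro k j hkj x t
    rw [lTilGam, lTilGam]
    congr 2
    refine Finset.sum_congr rfl fun i hi => ?_
    rw [Function.update_of_ne]
    exact ((Finset.mem_Iio.1 hi).trans_le hkj).ne
  have hprod : ∀ x, (Cgam L lstar γ).indicator
      (fun x => ENNReal.ofReal (exp (-psiGam L lstar γ x μ) * phiD x)) x = ∏ k, f k x := by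
    intro x
    by_cases hx : x ∈ Cgam L lstar γ
    · rw [Set.indicator_of_mem hx, exp_neg_psiGam_mul_phiD, ENNReal.ofReal_prod_of_nonneg
        fun k _ => (div_pos (stdPdf_pos _) (one_sub_Phi_pos _)).le]
      refine Finset.prod_congr rfl fun k _ => ?_
      exact (if_pos ((mem_Cgam_iff hLow hDiag).1 hx k)).symm
    · rw [Set.indicator_of_notMem hx]
      rw [mem_Cgam_iff hLow hDiag, not_forall] at hx
      obtain ⟨k, hk⟩ := hx
      exact (Finset.prod_eq_zero (Finset.mem_univ k) (if_neg hk)).symm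
  rw [← lintegral_indicator measurableSet_Cgam, lintegral_congr hprod]
  refine lintegral_prod_sequential_le_one hf (fun k j hkj x t => ?_) fun k x => ?_
  · simp only [f, hlt k j hkj.le, Function.update_of_ne hkj.ne]
  · set a := lTilGam L lstar γ x k with ha
    have h1 : ∀ t, f k (Function.update x k t) = Set.indicator (Set.Ici a)
        (fun t => ENNReal.ofReal (stdPdf (t - μ k) / (1 - Phi (a - μ k)))) t := fun t => by
      simp only [f, Set.indicator, hlt k k le_rfl, Function.update_self,
        Set.mem_Ici, ha]
    have hint : Integrable fun t => stdPdf (t - μ k) / (1 - Phi (a - μ k)) :=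
      (integrable_stdPdf.comp_sub_right (μ k)).div_const _
    have hshift : ∫ t in Set.Ioi a, stdPdf (t - μ k) = ∫ t in Set.Ioi (a - μ k), stdPdf t := by
      have h := (measurePreserving_sub_right volume (μ k)).setIntegral_preimage_emb
        (measurableEmbedding_subRight (μ k)) stdPdf (Set.Ioi (a - μ k))
      simpa using h
    rw [lintegral_congr h1, lintegral_indicator measurableSet_Ici,
      ← ofReal_integral_eq_lintegral_ofReal hint.integrableOn
        (ae_of_all _ fun t => (div_pos (stdPdf_pos _) (one_sub_Phi_pos _)).le),
      integral_Ici_eq_integral_Ioi, integral_div, hshift, ← one_sub_Phi, div_self (one_sub_Phi_pos _).ne', ENNReal.ofReal_one]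

/-- The second moment of the estimator dominates the square of its mean. -/
lemma ellGam_sq_le (hLow : ∀ i j : Fin d, i < j → L i j = 0) (hDiag : ∀ i, 0 < L i i)
    (γ : ℝ) (μ : Fin d → ℝ)
    (hint : IntegrableOn (fun x => exp (psiGam L lstar γ x μ) * phiD x) (Cgam L lstar γ)) :
    ellGam L lstar γ ^ 2 ≤ ∫ x in Cgam L lstar γ, exp (psiGam L lstar γ x μ) * phiD x := by
  set g : (Fin d → ℝ) → ℝ := fun x => exp (-psiGam L lstar γ x μ) * phiD x with hg
  have hg0 : ∀ x, 0 ≤ g x := fun x => mul_nonneg (exp_pos _).le (phiD_pos x).le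
  have hgm : Measurable g :=
    (measurable_psiGam μ).neg.exp.mul continuous_phiD.measurable
  have hle := lintegral_tilted_le_one (lstar := lstar) hLow hDiag γ μ
  have hgint : IntegrableOn g (Cgam L lstar γ) := by
    refine ⟨hgm.aestronglyMeasurable, ?_⟩
    rw [hasFiniteIntegral_iff_ofReal (ae_of_all _ hg0)]
    exact hle.trans_lt ENNReal.one_lt_top
  have hg1 : ∫ x in Cgam L lstar γ, g x ≤ 1 := by
    rw [integral_eq_lintegral_of_nonneg_ae (ae_of_all _ hg0) hgm.aestronglyMeasurable]
    exact ENNReal.toReal_le_of_le_ofReal zero_le_one (by simpa using hle)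
  set ℓ := ellGam L lstar γ with hℓ
  have hmono : ∫ x in Cgam L lstar γ, 2 * ℓ * phiD x ≤
      ∫ x in Cgam L lstar γ, (exp (psiGam L lstar γ x μ) * phiD x + ℓ ^ 2 * g x) := by
    refine setIntegral_mono (integrable_phiD.integrableOn.const_mul _)
      (hint.add (hgint.const_mul _)) fun x => ?_
    have hφ := (phiD_pos x).le
    simp only [hg, exp_neg]
    have he := exp_pos (psiGam L lstar γ x μ)
    have : 2 * ℓ ≤ exp (psiGam L lstar γ x μ) + ℓ ^ 2 * (exp (psiGam L lstar γ x μ))⁻¹ := by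
      rw [← div_eq_mul_inv, ← sub_nonneg]
      have : exp (psiGam L lstar γ x μ) + ℓ ^ 2 / exp (psiGam L lstar γ x μ) - 2 * ℓ =
          (exp (psiGam L lstar γ x μ) - ℓ) ^ 2 / exp (psiGam L lstar γ x μ) := by
        field_simp; ring
      rw [this]; positivity
    nlinarith [mul_le_mul_of_nonneg_right this hφ]
  rw [integral_const_mul, integral_add hint (hgint.const_mul _), integral_const_mul] at hmono
  have : ∫ x in Cgam L lstar γ, phiD x = ℓ := rfl
  rw [this] at hmono
  nlinarith [mul_le_mul_of_nonneg_left hg1 (sq_nonneg ℓ)]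

lemma dotProduct_mulVec_mul_transpose (v : Fin d → ℝ) :
    ∑ k, v k * (L * Lᵀ).mulVec v k = ∑ k, Lᵀ.mulVec v k ^ 2 := by
  have h : v ⬝ᵥ (L * Lᵀ).mulVec v = Lᵀ.mulVec v ⬝ᵥ Lᵀ.mulVec v := by
    rw [← Matrix.mulVec_mulVec, Matrix.dotProduct_mulVec, ← Matrix.mulVec_transpose]
  simpa [dotProduct, sq] using h

lemma sum_transpose_mulVec_mul (v x : Fin d → ℝ) :
    ∑ k, Lᵀ.mulVec v k * x k = ∑ k, v k * L.mulVec x k := by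
  have h : v ⬝ᵥ L.mulVec x = Lᵀ.mulVec v ⬝ᵥ x := by
    rw [Matrix.dotProduct_mulVec, ← Matrix.mulVec_transpose]
  simpa [dotProduct] using h.symm

variable (L lstar) in
/-- The asymptotically optimal tilting parameter. -/
noncomputable def asympTilt (γ : ℝ) (k : Fin d) : ℝ :=
  γ * (Lᵀ.mulVec lstar k - L k k * lstar k)

variable (L lstar) in
/-- The asymptotic approximation of `ellGam`, bounding `exp ∘ psiGam` at `asympTilt`. -/
noncomputable def tailApprox (γ : ℝ) : ℝ :=
  (∏ k, (√(2 * π))⁻¹ / (γ * L k k * lstar k)) *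
    exp (-(∑ k, (γ * Lᵀ.mulVec lstar k) ^ 2) / 2)

lemma tailApprox_pos (hDiag : ∀ i, 0 < L i i) (hlstar : ∀ k, 0 < lstar k) {γ : ℝ}
    (hγ : 0 < γ) : 0 < tailApprox L lstar γ :=
  mul_pos (Finset.prod_pos fun k _ => by
    have := hDiag k
    have := hlstar k
    positivity) (exp_pos _)

lemma psiGam_asympTilt_le (hLow : ∀ i j : Fin d, i < j → L i j = 0) (hDiag : ∀ i, 0 < L i i)
    (hlstar : ∀ k, 0 < lstar k) {γ : ℝ} (hγ : 0 < γ) (x : Fin d → ℝ) :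
    psiGam L lstar γ x (asympTilt L lstar γ) ≤ log (tailApprox L lstar γ) := by
  set m := asympTilt L lstar γ with hm
  set s : Fin d → ℝ := fun k => γ * L k k * lstar k with hs
  have hs0 : ∀ k, 0 < s k := fun k => mul_pos (mul_pos hγ (hDiag k)) (hlstar k)
  have hc : ∀ k, 0 < (√(2 * π))⁻¹ / s k := fun k => by
    have := hs0 k
    positivity
  have hlog : ∀ k, log (1 - Phi (lTilGam L lstar γ x k - m k)) ≤
      log ((√(2 * π))⁻¹ / s k) + (s k ^ 2 / 2 - s k * (lTilGam L lstar γ x k - m k)) := by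
    intro k
    rw [← log_exp (s k ^ 2 / 2 - s k * (lTilGam L lstar γ x k - m k)),
      ← log_mul (hc k).ne' (exp_pos _).ne']
    exact log_le_log (one_sub_Phi_pos _) (one_sub_Phi_le (hs0 k) _)
  have hl : ∀ k, s k * lTilGam L lstar γ x k = γ ^ 2 * (lstar k * (L * Lᵀ).mulVec lstar k)
      - γ * (lstar k * L.mulVec x k) + s k * x k := by
    intro k
    rw [lTilGam, mulVec_eq_sum_Iio_add hLow x k, hs]
    have := (hDiag k).ne'
    field_simp
    ring
  have hms : ∀ k, γ * Lᵀ.mulVec lstar k = m k + s k := fun k => by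
    rw [hm, hs, asympTilt]; ring
  have e1 : ∑ k, s k * lTilGam L lstar γ x k =
      ∑ k, (m k + s k) ^ 2 - ∑ k, (m k + s k) * x k + ∑ k, s k * x k := by
    simp only [hl, Finset.sum_add_distrib, Finset.sum_sub_distrib, ← Finset.mul_sum,
      dotProduct_mulVec_mul_transpose, ← sum_transpose_mulVec_mul]
    simp only [Finset.mul_sum, ← mul_pow, ← mul_assoc, hms]
  rw [tailApprox, log_mul (Finset.prod_pos fun k _ => hc k).ne' (exp_pos _).ne', log_exp,
    log_prod fun k _ => (hc k).ne', psiGam]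
  simp only [hms]
  refine (add_le_add_right (Finset.sum_le_sum fun k _ => hlog k) _).trans (le_of_eq ?_)
  simp only [mul_sub, Finset.sum_add_distrib, Finset.sum_sub_distrib, e1]
  rw [← sub_eq_zero]
  simp only [add_sq, add_mul, Finset.sum_add_distrib, ← Finset.sum_div, mul_comm (x _),
    mul_assoc, ← Finset.mul_sum, mul_comm (s _) (m _)]
  ring

lemma det_pos_of_lowerTriangular (hLow : ∀ i j : Fin d, i < j → L i j = 0)
    (hDiag : ∀ i, 0 < L i i) : L.det = ∏ k, L k k ∧ 0 < L.det := by
  have h : L.det = ∏ k, L k k := Matrix.det_of_isLowerTriangular L fun i j hij => hLow i j hij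
  exact ⟨h, h ▸ Finset.prod_pos fun k _ => hDiag k⟩

lemma ellGam_eq (hLow : ∀ i j : Fin d, i < j → L i j = 0) (hDiag : ∀ i, 0 < L i i)
    {γ : ℝ} (hγ : 0 < γ) :
    ellGam L lstar γ = (∏ k, (√(2 * π))⁻¹ / (γ * L k k)) *
      exp (-(∑ k, (γ * Lᵀ.mulVec lstar k) ^ 2) / 2) *
      ∫ w in Set.univ.pi fun _ : Fin d => Set.Ici (0 : ℝ),
        exp (-(∑ k, (γ⁻¹ * L⁻¹.mulVec w k) ^ 2) / 2) * ∏ k, exp (-lstar k * w k) := by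
  obtain ⟨hdet, hdet0⟩ := det_pos_of_lowerTriangular hLow hDiag
  have hu : IsUnit L.det := hdet0.ne'.isUnit
  let A : (Fin d → ℝ) →L[ℝ] (Fin d → ℝ) := γ⁻¹ • (Matrix.toLin' L⁻¹).toContinuousLinearMap
  let F : (Fin d → ℝ) → Fin d → ℝ := fun w => γ • Lᵀ.mulVec lstar + A w
  have hA : ∀ w, A w = γ⁻¹ • L⁻¹.mulVec w := fun w => by simp [A]
  have hLA : ∀ w, L.mulVec (A w) = γ⁻¹ • w := fun w => by
    rw [hA, Matrix.mulVec_smul, Matrix.mulVec_mulVec, Matrix.mul_nonsing_inv L hu,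
      Matrix.one_mulVec]
  have hAL : ∀ w, A (L.mulVec w) = γ⁻¹ • w := fun w => by
    rw [hA, Matrix.mulVec_mulVec, Matrix.nonsing_inv_mul L hu, Matrix.one_mulVec]
  have hdetA : |A.det| = ∏ k, (γ * L k k)⁻¹ := by
    have : A.det = (γ ^ d)⁻¹ * L.det⁻¹ := by
      change LinearMap.det (γ⁻¹ • Matrix.toLin' L⁻¹) = _
      rw [LinearMap.det_smul, LinearMap.det_toLin', Matrix.det_nonsing_inv,
        Ring.inverse_eq_inv']
      simp
    rw [this, abs_of_pos (by positivity), hdet, Finset.prod_inv_distrib, Finset.prod_mul_distrib]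
    simp [mul_comm]
  have himg : F '' (Set.univ.pi fun _ => Set.Ici 0) = Cgam L lstar γ := by
    ext x
    have hF : ∀ w, L.mulVec (F w) = γ • (L * Lᵀ).mulVec lstar + γ⁻¹ • w := fun w => by
      rw [Matrix.mulVec_add, hLA, Matrix.mulVec_smul, Matrix.mulVec_mulVec]
    constructor
    · rintro ⟨w, hw, rfl⟩ i
      rw [hF]
      have : 0 ≤ w i := hw i trivial
      simpa using by positivity
    · intro hx
      refine ⟨γ • (L.mulVec x - γ • (L * Lᵀ).mulVec lstar), fun i _ => ?_, ?_⟩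
      · have := hx i
        simp only [Set.mem_Ici, Pi.smul_apply, Pi.sub_apply, smul_eq_mul]
        exact mul_nonneg hγ.le (by linarith)
      · have h1 : A (γ • (L.mulVec x - γ • (L * Lᵀ).mulVec lstar)) =
            x - γ • Lᵀ.mulVec lstar := by
          rw [← Matrix.mulVec_mulVec, ← Matrix.mulVec_smul, ← Matrix.mulVec_sub, map_smul, hAL,
            smul_inv_smul₀ hγ.ne']
        simp only [F, h1]
        abel
  have hinj : Set.InjOn F (Set.univ.pi fun _ => Set.Ici 0) := by
    intro w _ w' _ h
    have h2 : L.mulVec (A w) = L.mulVec (A w') := congrArg _ (add_left_cancel h)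
    rw [hLA, hLA] at h2
    exact smul_right_injective _ (inv_ne_zero hγ.ne') h2
  rw [ellGam, ← himg, integral_image_eq_integral_abs_det_fderiv_smul volume
    (MeasurableSet.univ_pi fun _ => measurableSet_Ici)
    (fun w _ => (A.hasFDerivAt.const_add _).hasFDerivWithinAt) hinj, ← integral_const_mul]
  refine integral_congr_ae (ae_of_all _ fun w => ?_)
  simp only [hdetA, smul_eq_mul, div_eq_mul_inv, Finset.prod_mul_distrib, Finset.prod_const,
    Finset.card_univ, Fintype.card_fin, phiD, inv_pow, ← exp_sum]
  have hexp : -(∑ k, F w k ^ 2) * 2⁻¹ = -(∑ k, (γ * Lᵀ.mulVec lstar k) ^ 2) * 2⁻¹ +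
      (-(∑ k, (γ⁻¹ * L⁻¹.mulVec w k) ^ 2) * 2⁻¹ + ∑ k, -lstar k * w k) := by
    have hFk : ∀ k, F w k = γ * Lᵀ.mulVec lstar k + γ⁻¹ * L⁻¹.mulVec w k := fun k => by
      simp [F, hA]
    have hcross : ∑ k, Lᵀ.mulVec lstar k * L⁻¹.mulVec w k = ∑ k, lstar k * w k := by
      rw [sum_transpose_mulVec_mul, Matrix.mulVec_mulVec, Matrix.mul_nonsing_inv L hu,
        Matrix.one_mulVec]
    have hsq : ∀ k, F w k ^ 2 = (γ * Lᵀ.mulVec lstar k) ^ 2 +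
        2 * (Lᵀ.mulVec lstar k * L⁻¹.mulVec w k) + (γ⁻¹ * L⁻¹.mulVec w k) ^ 2 := fun k => by
      rw [hFk]; field_simp; ring
    simp only [hsq, Finset.sum_add_distrib, ← Finset.mul_sum, hcross, neg_mul,
      Finset.sum_neg_distrib]
    ring
  rw [hexp, exp_add, exp_add]
  ring

lemma tendsto_integral_exp_neg (hlstar : ∀ k, 0 < lstar k) :
    Tendsto (fun γ : ℝ => ∫ w in Set.univ.pi fun _ : Fin d => Set.Ici (0 : ℝ),
      exp (-(∑ k, (γ⁻¹ * L⁻¹.mulVec w k) ^ 2) / 2) * ∏ k, exp (-lstar k * w k))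
      atTop (nhds (∏ k, (lstar k)⁻¹)) := by
  have hrestrict : (volume : Measure (Fin d → ℝ)).restrict (Set.univ.pi fun _ => Set.Ici 0) =
      Measure.pi fun _ => (volume : Measure ℝ).restrict (Set.Ici 0) :=
    Measure.restrict_pi_pi _ _
  have hint1 : ∀ k, Integrable (fun t => exp (-lstar k * t)) (volume.restrict (Set.Ici 0)) :=
    fun k => (integrableOn_Ici_iff_integrableOn_Ioi).2
      (integrableOn_exp_mul_Ioi (neg_lt_zero.2 (hlstar k)) 0)
  have hval : ∫ w in Set.univ.pi fun _ : Fin d => Set.Ici (0 : ℝ), ∏ k, exp (-lstar k * w k) =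
      ∏ k, (lstar k)⁻¹ := by
    rw [hrestrict, integral_fintype_prod_eq_prod fun k t => exp (-lstar k * t)]
    refine Finset.prod_congr rfl fun k _ => ?_
    rw [integral_Ici_eq_integral_Ioi, integral_exp_mul_Ioi (neg_lt_zero.2 (hlstar k))]
    simp [neg_div_neg_eq]
  rw [← hval]
  have hmv : Measurable fun w => L⁻¹.mulVec w := by
    unfold Matrix.mulVec dotProduct
    fun_prop
  refine tendsto_integral_filter_of_dominated_convergence
    (fun w => ∏ k, exp (-lstar k * w k)) (Eventually.of_forall fun γ => ?_)
    (Eventually.of_forall fun γ => ae_of_all _ fun w => ?_) ?_ (ae_of_all _ fun w => ?_)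
  · exact Measurable.aestronglyMeasurable (by fun_prop)
  · rw [norm_of_nonneg (by positivity)]
    refine mul_le_of_le_one_left (by positivity) (exp_le_one_iff.2 ?_)
    have : 0 ≤ ∑ k, (γ⁻¹ * L⁻¹.mulVec w k) ^ 2 := by positivity
    linarith
  · rw [hrestrict]
    exact Integrable.fintype_prod hint1
  · have h : Tendsto (fun γ : ℝ => exp (-(∑ k, (γ⁻¹ * L⁻¹.mulVec w k) ^ 2) / 2) *
        ∏ k, exp (-lstar k * w k)) atTop
        (nhds (exp (-(∑ k, (0 * L⁻¹.mulVec w k) ^ 2) / 2) * ∏ k, exp (-lstar k * w k))) := by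
      refine Tendsto.mul_const _ ((continuous_exp.tendsto _).comp ?_)
      refine Tendsto.div_const (Tendsto.neg (tendsto_finsetSum _ fun k _ => ?_)) 2
      exact (tendsto_inv_atTop_zero.mul_const _).pow 2
    simpa using h

lemma tendsto_tailApprox_div_ellGam (hLow : ∀ i j : Fin d, i < j → L i j = 0)
    (hDiag : ∀ i, 0 < L i i) (hlstar : ∀ k, 0 < lstar k) :
    Tendsto (fun γ : ℝ => tailApprox L lstar γ / ellGam L lstar γ) atTop (nhds 1) := by
  have hP : ∏ k, (lstar k)⁻¹ ≠ 0 :=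
    (Finset.prod_pos fun k _ => inv_pos.2 (hlstar k)).ne'
  have h := (tendsto_const_nhds (x := ∏ k, (lstar k)⁻¹)).div
    (tendsto_integral_exp_neg (L := L) hlstar) hP
  rw [div_self hP] at h
  refine h.congr' ?_
  filter_upwards [eventually_gt_atTop 0] with γ hγ
  have hK : (∏ k, (√(2 * π))⁻¹ / (γ * L k k)) *
      exp (-(∑ k, (γ * Lᵀ.mulVec lstar k) ^ 2) / 2) ≠ 0 :=
    (mul_pos (Finset.prod_pos fun k _ => by have := hDiag k; positivity) (exp_pos _)).ne'
  have hsplit : tailApprox L lstar γ = (∏ k, (√(2 * π))⁻¹ / (γ * L k k)) *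
      exp (-(∑ k, (γ * Lᵀ.mulVec lstar k) ^ 2) / 2) * ∏ k, (lstar k)⁻¹ := by
    rw [tailApprox, mul_right_comm, ← Finset.prod_mul_distrib]
    congr 1
    refine Finset.prod_congr rfl fun k _ => ?_
    rw [← div_eq_mul_inv, div_div]
  rw [hsplit, ellGam_eq hLow hDiag hγ, mul_div_mul_left _ _ hK]
  rfl

lemma tendsto_tailApprox (hd : 1 ≤ d) : Tendsto (tailApprox L lstar) atTop (nhds 0) := by
  set c := ∏ k, (√(2 * π))⁻¹ / (L k k * lstar k) with hc
  have h0 : Tendsto (fun γ : ℝ => |c| * (γ ^ d)⁻¹) atTop (nhds 0) := by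
    simpa using ((tendsto_pow_atTop (Nat.one_le_iff_ne_zero.1 hd)).inv_tendsto_atTop).const_mul |c|
  refine squeeze_zero_norm' ?_ h0
  filter_upwards [eventually_gt_atTop 0] with γ hγ
  have hsplit : ∏ k, (√(2 * π))⁻¹ / (γ * L k k * lstar k) = c * (γ ^ d)⁻¹ := by
    have : (γ ^ d)⁻¹ = ∏ _k : Fin d, γ⁻¹ := by simp
    rw [hc, this, ← Finset.prod_mul_distrib]
    refine Finset.prod_congr rfl fun k _ => ?_
    rw [← div_eq_mul_inv, div_div, mul_assoc, mul_comm γ]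
  rw [tailApprox, hsplit, norm_mul, norm_mul, norm_eq_abs, norm_of_nonneg (exp_pos _).le,
    norm_of_nonneg (by positivity)]
  refine mul_le_of_le_one_right (by positivity) (exp_le_one_iff.2 ?_)
  have : 0 ≤ ∑ k, (γ * Lᵀ.mulVec lstar k) ^ 2 := by positivity
  linarith

end Tilting

/-- Theorem 3, first part: with lower bound l = γΣl*, l* > 0, the minimax
exponentially tilted estimator has vanishing relative error: M(γ)/ℓ(γ)² → 1 as γ → ∞. -/
theorem minimax_VRE_sigma_lstar {d : ℕ} (hd : 1 ≤ d)
    (L : Matrix (Fin d) (Fin d) ℝ)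
    (hLow : ∀ i j : Fin d, i < j → L i j = 0)
    (hDiag : ∀ i, 0 < L i i)
    (lstar : Fin d → ℝ) (hlstar : ∀ k, 0 < lstar k)
    (μstar : ℝ → Fin d → ℝ)
    (hmin : ∀ γ : ℝ, 0 < γ → ∀ μ : Fin d → ℝ,
      sSup ((fun x => psiGam L lstar γ x (μstar γ)) '' Cgam L lstar γ) ≤
        sSup ((fun x => psiGam L lstar γ x μ) '' Cgam L lstar γ)) :
    Tendsto (fun γ : ℝ => Mgam L lstar μstar γ / (ellGam L lstar γ) ^ 2) atTop (nhds 1) := by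

  have hratio := tendsto_tailApprox_div_ellGam hLow hDiag hlstar
  have hlt1 : ∀ᶠ γ in atTop, tailApprox L lstar γ < 1 :=
    (tendsto_tailApprox hd).eventually (gt_mem_nhds one_pos)
  have hpos : ∀ᶠ γ in atTop, 0 < tailApprox L lstar γ / ellGam L lstar γ :=
    hratio.eventually (lt_mem_nhds one_pos)
  have hbounds : ∀ᶠ γ in atTop, 1 ≤ Mgam L lstar μstar γ / ellGam L lstar γ ^ 2 ∧
      Mgam L lstar μstar γ / ellGam L lstar γ ^ 2 ≤
        tailApprox L lstar γ / ellGam L lstar γ := by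
    filter_upwards [eventually_gt_atTop 0, hlt1, hpos] with γ hγ hU1 hquot
    have hU0 := tailApprox_pos hDiag hlstar hγ
    have hℓ : 0 < ellGam L lstar γ := (div_pos_iff_of_pos_left hU0).1 hquot
    have hlogneg : log (tailApprox L lstar γ) < 0 := log_neg hU0 hU1
    have hne : (Cgam L lstar γ).Nonempty := by
      by_contra h
      rw [Set.not_nonempty_iff_eq_empty] at h
      simp [ellGam, h] at hℓ
    have hsup : sSup ((fun x => psiGam L lstar γ x (μstar γ)) '' Cgam L lstar γ) ≤
        log (tailApprox L lstar γ) := by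
      refine (hmin γ hγ (asympTilt L lstar γ)).trans (csSup_le (hne.image _) ?_)
      rintro _ ⟨x, -, rfl⟩
      exact psiGam_asympTilt_le hLow hDiag hlstar hγ x
    have hbdd : BddAbove ((fun x => psiGam L lstar γ x (μstar γ)) '' Cgam L lstar γ) := by
      by_contra h
      rw [Real.sSup_of_not_bddAbove h] at hsup
      linarith
    have hψ : ∀ x ∈ Cgam L lstar γ,
        exp (psiGam L lstar γ x (μstar γ)) * phiD x ≤ tailApprox L lstar γ * phiD x := by
      intro x hx
      refine mul_le_mul_of_nonneg_right ?_ (phiD_pos x).le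
      rw [← le_log_iff_exp_le hU0]
      exact (le_csSup hbdd ⟨x, hx, rfl⟩).trans hsup
    have hintU : IntegrableOn (fun x => tailApprox L lstar γ * phiD x) (Cgam L lstar γ) :=
      integrable_phiD.integrableOn.const_mul _
    have hint : IntegrableOn (fun x => exp (psiGam L lstar γ x (μstar γ)) * phiD x)
        (Cgam L lstar γ) := by
      refine hintU.mono'
        ((measurable_psiGam _).exp.mul continuous_phiD.measurable).aestronglyMeasurable ?_
      filter_upwards [ae_restrict_mem measurableSet_Cgam] with x hx
      rw [norm_of_nonneg (mul_nonneg (exp_pos _).le (phiD_pos x).le)]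
      exact hψ x hx
    have hupper : Mgam L lstar μstar γ ≤ tailApprox L lstar γ * ellGam L lstar γ := by
      rw [ellGam, ← integral_const_mul]
      exact setIntegral_mono_on hint hintU measurableSet_Cgam hψ
    have hlower : ellGam L lstar γ ^ 2 ≤ Mgam L lstar μstar γ :=
      ellGam_sq_le hLow hDiag γ (μstar γ) hint
    refine ⟨(one_le_div (by positivity)).2 hlower, ?_⟩
    rw [div_le_div_iff₀ (by positivity) hℓ]
    nlinarith
  exact tendsto_of_tendsto_of_tendsto_of_le_of_le' tendsto_const_nhds hratio
    (hbounds.mono fun _ => And.left) (hbounds.mono fun _ => And.right)
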